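/- (Injectivity of (L, M, T) on symmetric 2-tensor fields.) Let f be a symmetric 2-tensor field on ℝ² with components f₁₁, f₁₂, f₂₂ smooth and supported in the open unit disk 𝔻. If Lf(φ, ψ) = 0, Tf(φ, ψ) = 0, and Mf(φ, ψ) = 0 for all (φ, ψ) ∈ [0, 2π) × (0, π/2), then f₁₁ = f₁₂ = f₂₂ = 0. -/

import Mathlib

open Real MeasureTheory Set

noncomputable section

/-- The unit vector at polar angle `θ`. -/
def Phi (θ : ℝ) : ℝ × ℝ := (Real.cos θ, Real.sin θ)

/-- Rotation of a vector by 90° counterclockwise. -/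
def perp (w : ℝ × ℝ) : ℝ × ℝ := (-w.2, w.1)

/-- Euclidean dot product on `ℝ × ℝ`. -/
def dot (a b : ℝ × ℝ) : ℝ := a.1 * b.1 + a.2 * b.2

/-- The open unit disk in the plane. -/
def unitDisk : Set (ℝ × ℝ) := {x | x.1 ^ 2 + x.2 ^ 2 < 1}

/-- The closed unit disk in the plane. -/
def closedUnitDisk : Set (ℝ × ℝ) := {x | x.1 ^ 2 + x.2 ^ 2 ≤ 1}

/-- The unit circle in the plane. -/
def unitCircle : Set (ℝ × ℝ) := {x | x.1 ^ 2 + x.2 ^ 2 = 1}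

/-- The Radon transform of a scalar function. -/
def radon (h : ℝ × ℝ → ℝ) (s θ : ℝ) : ℝ :=
  ∫ t : ℝ, h (s • Phi θ + t • Phi (θ + π / 2))

/-- The weighted V-line transform of a scalar function, with weights `c₁, c₂`. -/
def Vw (c₁ c₂ : ℝ) (h : ℝ × ℝ → ℝ) (φ ψ : ℝ) : ℝ :=
  c₁ * (∫ t in Ioi (0 : ℝ), h (Phi φ + t • Phi (π + φ - ψ))) +
  c₂ * (∫ t in Ioi (0 : ℝ), h (Phi φ + t • Phi (π + φ + ψ)))

/-- The `n`-th (complex) Fourier coefficient of a function of the angular variable. -/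
def fourierCoeff' (g : ℝ → ℝ) (n : ℤ) : ℂ :=
  (1 / (2 * (π : ℂ))) * ∫ φ in (0 : ℝ)..(2 * π), (g φ : ℂ) * Complex.exp (-Complex.I * n * φ)

/-- The pairing `⟨ab, f⟩` of the symmetric product of two vectors with a symmetric 2-tensor
field with components `f₁₁, f₁₂, f₂₂`, at the point `x`. -/
def pair2 (a b : ℝ × ℝ) (f11 f12 f22 : ℝ × ℝ → ℝ) (x : ℝ × ℝ) : ℝ :=
  a.1 * b.1 * f11 x + (a.1 * b.2 + a.2 * b.1) * f12 x + a.2 * b.2 * f22 x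

/-- The longitudinal V-line transform of a symmetric 2-tensor field. -/
def L2 (f11 f12 f22 : ℝ × ℝ → ℝ) (φ ψ : ℝ) : ℝ :=
  (∫ t in Ioi (0 : ℝ),
    pair2 (Phi (π + φ - ψ)) (Phi (π + φ - ψ)) f11 f12 f22 (Phi φ + t • Phi (π + φ - ψ))) +
  (∫ t in Ioi (0 : ℝ),
    pair2 (Phi (π + φ + ψ)) (Phi (π + φ + ψ)) f11 f12 f22 (Phi φ + t • Phi (π + φ + ψ)))

/-- The transverse V-line transform of a symmetric 2-tensor field. -/
def T2 (f11 f12 f22 : ℝ × ℝ → ℝ) (φ ψ : ℝ) : ℝ :=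
  (∫ t in Ioi (0 : ℝ),
    pair2 (perp (Phi (π + φ - ψ))) (perp (Phi (π + φ - ψ))) f11 f12 f22
      (Phi φ + t • Phi (π + φ - ψ))) +
  (∫ t in Ioi (0 : ℝ),
    pair2 (perp (Phi (π + φ + ψ))) (perp (Phi (π + φ + ψ))) f11 f12 f22
      (Phi φ + t • Phi (π + φ + ψ)))

/-- The mixed V-line transform of a symmetric 2-tensor field. -/
def M2 (f11 f12 f22 : ℝ × ℝ → ℝ) (φ ψ : ℝ) : ℝ :=
  (∫ t in Ioi (0 : ℝ),
    pair2 (perp (Phi (π + φ - ψ))) (Phi (π + φ - ψ)) f11 f12 f22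
      (Phi φ + t • Phi (π + φ - ψ))) +
  (∫ t in Ioi (0 : ℝ),
    pair2 (perp (Phi (π + φ + ψ))) (Phi (π + φ + ψ)) f11 f12 f22
      (Phi φ + t • Phi (π + φ + ψ)))

open scoped FourierTransform

/-- The Radon transform of a complex-valued function on the plane. -/
def complexRadon (h : ℝ × ℝ → ℂ) (s θ : ℝ) : ℂ :=
  ∫ t : ℝ, h (s • Phi θ + t • Phi (θ + π / 2))

theorem Phi_add_two_pi (θ : ℝ) : Phi (θ + 2 * π) = Phi θ := by
  simp [Phi]

theorem Phi_add_pi (θ : ℝ) : Phi (θ + π) = -Phi θ := by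
  simp [Phi]

theorem continuous_Phi : Continuous Phi := by
  unfold Phi
  fun_prop

theorem eq_zero_of_one_le {h : ℝ × ℝ → ℂ} (hs : Function.support h ⊆ unitDisk) {x : ℝ × ℝ}
    (hx : 1 ≤ x.1 ^ 2 + x.2 ^ 2) : h x = 0 := by
  by_contra hne
  have : x.1 ^ 2 + x.2 ^ 2 < 1 := hs hne
  linarith

theorem line_normSq (s t θ : ℝ) :
    (s • Phi θ + t • Phi (θ + π / 2)).1 ^ 2 + (s • Phi θ + t • Phi (θ + π / 2)).2 ^ 2 =
      s ^ 2 + t ^ 2 := by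
  simp only [Phi, Real.cos_add_pi_div_two, Real.sin_add_pi_div_two, Prod.fst_add, Prod.snd_add,
    Prod.smul_fst, Prod.smul_snd, smul_eq_mul]
  linear_combination (s ^ 2 + t ^ 2) * Real.sin_sq_add_cos_sq θ

theorem complexRadon_periodic (h : ℝ × ℝ → ℂ) (s : ℝ) :
    Function.Periodic (complexRadon h s) (2 * π) := by
  intro θ
  simp only [complexRadon]
  rw [Phi_add_two_pi, show θ + 2 * π + π / 2 = θ + π / 2 + 2 * π by ring, Phi_add_two_pi]

theorem complexRadon_neg (h : ℝ × ℝ → ℂ) (s θ : ℝ) :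
    complexRadon h (-s) θ = complexRadon h s (θ + π) := by
  simp only [complexRadon]
  rw [Phi_add_pi, show θ + π + π / 2 = θ + π / 2 + π by ring, Phi_add_pi,
    ← integral_neg_eq_self]
  simp

theorem complexRadon_eq_zero_of_one_le_abs {h : ℝ × ℝ → ℂ} (hs : Function.support h ⊆ unitDisk)
    {s : ℝ} (hs1 : 1 ≤ |s|) (θ : ℝ) : complexRadon h s θ = 0 := by
  unfold complexRadon
  rw [← integral_zero ℝ ℂ]
  congr 1
  ext t
  apply eq_zero_of_one_le hs
  rw [line_normSq]
  have := one_le_sq_iff_one_le_abs s |>.mpr hs1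
  nlinarith [sq_nonneg t]

theorem complexRadon_eq_intervalIntegral {h : ℝ × ℝ → ℂ} (hs : Function.support h ⊆ unitDisk)
    (s θ : ℝ) :
    complexRadon h s θ = ∫ t in (-1 : ℝ)..1, h (s • Phi θ + t • Phi (θ + π / 2)) := by
  rw [intervalIntegral.integral_of_le (by norm_num), complexRadon,
    setIntegral_eq_integral_of_forall_compl_eq_zero]
  intro t ht
  apply eq_zero_of_one_le hs
  rw [line_normSq]
  have : 1 ≤ |t| := by
    by_contra hlt
    rw [not_le, abs_lt] at hlt
    exact ht ⟨hlt.1, hlt.2.le⟩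
  have := one_le_sq_iff_one_le_abs t |>.mpr this
  nlinarith [sq_nonneg s]

theorem continuous_complexRadon {h : ℝ × ℝ → ℂ} (hc : Continuous h)
    (hs : Function.support h ⊆ unitDisk) (s : ℝ) : Continuous (complexRadon h s) := by
  rw [show complexRadon h s = _ from funext (complexRadon_eq_intervalIntegral hs s)]
  apply intervalIntegral.continuous_parametric_intervalIntegral_of_continuous'
  have := continuous_Phi
  fun_prop

theorem hasCompactSupport_of_support_subset_unitDisk {h : ℝ × ℝ → ℂ}
    (hs : Function.support h ⊆ unitDisk) : HasCompactSupport h := by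
  refine HasCompactSupport.of_support_subset_isCompact
    (isCompact_closedBall (0 : ℝ × ℝ) 1) (hs.trans ?_)
  intro x hx
  have hx' : x.1 ^ 2 + x.2 ^ 2 < 1 := hx
  rw [mem_closedBall_zero_iff, Prod.norm_def, sup_le_iff, Real.norm_eq_abs, Real.norm_eq_abs,
    ← sq_le_one_iff_abs_le_one, ← sq_le_one_iff_abs_le_one]
  constructor <;> nlinarith [sq_nonneg x.1, sq_nonneg x.2]

/-- A continuous function supported in the unit disk is determined by its Radon transform. -/
theorem eq_zero_of_complexRadon_ae_eq_zero {h : ℝ × ℝ → ℂ} (hc : Continuous h)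
    (hs : Function.support h ⊆ unitDisk) (hR : ∀ θ, ∀ᵐ s, complexRadon h s θ = 0) : h = 0 := by
  set H : ℂ → ℂ := fun z => h (z.re, z.im) with hH
  have hHc : Continuous H := by fun_prop
  have hcs := hasCompactSupport_of_support_subset_unitDisk hs
  have hHi : Integrable H := by
    have := Complex.volume_preserving_equiv_real_prod.integrable_comp_of_integrable
      (hc.integrable_of_hasCompactSupport hcs)
    exact this
  have hF : 𝓕 H = 0 := by
    ext w
    set θ := Complex.arg w
    have hw : w = rotation (Circle.exp θ) (‖w‖ : ℂ) := by
      rw [rotation_apply, Circle.coe_exp, mul_comm, Complex.norm_mul_exp_arg_mul_I]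
    rw [hw, ← Real.fourier_comp_linearIsometry, Real.fourier_eq']
    have hpt : ∀ z : ℂ, (H ∘ rotation (Circle.exp θ)) z =
        h (z.re • Phi θ + z.im • Phi (θ + π / 2)) := by
      intro z
      simp only [hH, Function.comp, rotation_apply, Circle.coe_exp, Phi, Complex.mul_re,
        Complex.mul_im, Complex.exp_ofReal_mul_I_re, Complex.exp_ofReal_mul_I_im,
        Real.cos_add_pi_div_two, Real.sin_add_pi_div_two]
      congr 1
      ext <;> simp <;> ring
    let G : ℝ × ℝ → ℂ := fun p => Complex.exp (↑(-2 * π * (p.1 * ‖w‖)) * Complex.I) •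
      h (p.1 • Phi θ + p.2 • Phi (θ + π / 2))
    have hGs : Function.support G ⊆ unitDisk := by
      intro p hp
      by_contra hlt
      apply hp
      simp only [G]
      rw [eq_zero_of_one_le hs, smul_zero]
      rw [line_normSq]
      exact not_lt.mp hlt
    have hGc : Continuous G := by
      simp only [G]
      fun_prop
    have hGi : Integrable G :=
      hGc.integrable_of_hasCompactSupport (hasCompactSupport_of_support_subset_unitDisk hGs)
    have h1 : ∫ z : ℂ, Complex.exp (↑(-2 * π * inner ℝ z (‖w‖ : ℂ)) * Complex.I) •
        (H ∘ rotation (Circle.exp θ)) z = ∫ p, G p := by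
      rw [← Complex.volume_preserving_equiv_real_prod.integral_comp
        Complex.measurableEquivRealProd.measurableEmbedding]
      congr 1
      ext z
      rw [hpt]
      simp [G, Complex.inner, mul_comm]
    rw [h1, Measure.volume_eq_prod, integral_prod _ hGi, Pi.zero_apply]
    apply integral_eq_zero_of_ae
    filter_upwards [hR θ] with s hs0
    simp only [G, integral_smul]
    rw [complexRadon] at hs0
    rw [hs0]
    simp
  have hinv := hHc.fourierInv_fourier_eq hHi (by rw [hF]; exact integrable_zero _ _ _)
  ext x
  have : H ⟨x.1, x.2⟩ = 0 := by
    rw [← hinv, hF, Real.fourierInv_eq]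
    simp
  exact this

theorem periodic_eq_zero_of_phased_translates {g : ℝ → ℂ} (hc : Continuous g)
    (hp : Function.Periodic g (2 * π)) (A c : ℝ)
    (h : ∀ x ∈ Ico 0 (2 * π), Complex.exp (A * Complex.I) * g (x + c) +
      Complex.exp (-(A * Complex.I)) * g (x - c) = 0)
    (hcos : ∀ n : ℤ, Real.cos (A + n * c) ≠ 0) : g = 0 := by
  have : Fact (0 < 2 * π) := ⟨Real.two_pi_pos⟩
  let G : C(AddCircle (2 * π), ℂ) := ⟨hp.lift, continuous_coinduced_dom.mpr hc⟩
  have hG : ∀ x : ℝ, G x = g x := fun x => rfl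
  have hrel : ∀ y : AddCircle (2 * π), Complex.exp (A * Complex.I) * G (y + c) +
      Complex.exp (-(A * Complex.I)) * G (y - c) = 0 := by
    intro y
    have hy : y ∈ ((↑) : ℝ → AddCircle (2 * π)) '' Ico 0 (0 + 2 * π) := by
      rw [AddCircle.coe_image_Ico_eq]; trivial
    obtain ⟨x, hx, rfl⟩ := hy
    rw [zero_add] at hx
    exact h x hx
  have hshift : ∀ (n : ℤ) (d : ℝ), ∫ y : AddCircle (2 * π), fourier (-n) y * G (y + d)
      ∂AddCircle.haarAddCircle = Complex.exp (n * d * Complex.I) * fourierCoeff G n := by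
    intro n d
    rw [← integral_add_right_eq_self _ (-(d : AddCircle (2 * π))), fourierCoeff,
      ← integral_const_mul]
    congr 1
    ext y
    rw [neg_add_cancel_right]
    obtain ⟨x, rfl⟩ := QuotientAddGroup.mk_surjective y
    change fourier (-n) ((x : AddCircle (2 * π)) + -(d : AddCircle (2 * π))) * _ = _ *
      (fourier (-n) (x : AddCircle (2 * π)) • _)
    rw [← AddCircle.coe_neg, ← AddCircle.coe_add, fourier_coe_apply, fourier_coe_apply, smul_eq_mul,
      ← mul_assoc, ← Complex.exp_add]
    congr 2
    have : (π : ℂ) ≠ 0 := by exact_mod_cast Real.pi_ne_zero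
    push_cast
    field_simp
    ring
  have hcoeff : ∀ n : ℤ, fourierCoeff G n = 0 := by
    intro n
    have hint : ∀ d : ℝ, Integrable (fun y : AddCircle (2 * π) => fourier (-n) y * G (y + d))
        AddCircle.haarAddCircle := fun d =>
      (Continuous.integrable_of_hasCompactSupport (by fun_prop)
        (HasCompactSupport.of_compactSpace _))
    have h0 : Complex.exp (A * Complex.I) *
        (∫ y : AddCircle (2 * π), fourier (-n) y * G (y + c) ∂AddCircle.haarAddCircle) +
        Complex.exp (-(A * Complex.I)) *
        (∫ y : AddCircle (2 * π), fourier (-n) y * G (y + (-c : ℝ))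
          ∂AddCircle.haarAddCircle) = 0 := by
      rw [← integral_const_mul, ← integral_const_mul,
        ← integral_add ((hint c).const_mul _) ((hint (-c)).const_mul _)]
      apply integral_eq_zero_of_ae
      refine Filter.Eventually.of_forall fun y => ?_
      have := hrel y
      simp only [Pi.zero_apply]
      rw [AddCircle.coe_neg, ← sub_eq_add_neg]
      linear_combination (fourier (-n) y) * this
    rw [hshift, hshift, ← mul_assoc, ← mul_assoc, ← Complex.exp_add, ← Complex.exp_add,
      ← add_mul] at h0
    have h2 : Complex.exp (A * Complex.I + n * c * Complex.I) +
        Complex.exp (-(A * Complex.I) + n * (-c : ℝ) * Complex.I) =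
        2 * Complex.cos ((A + n * c : ℝ) : ℂ) := by
      rw [Complex.two_cos]
      push_cast
      ring_nf
    rw [h2, ← Complex.ofReal_cos] at h0
    refine (mul_eq_zero.mp h0).resolve_left (mul_ne_zero two_ne_zero ?_)
    exact_mod_cast hcos n
  have hsum := has_pointwise_sum_fourier_series_of_summable (f := G)
    (by rw [show fourierCoeff G = 0 from funext hcoeff]; exact summable_zero)
  ext x
  have := hsum x
  simp only [hcoeff, zero_smul] at this
  rw [← hG]
  exact this.unique hasSum_zero

/-- The integral of a complex-valued function over the ray from `Phi φ` in direction `Phi α`. -/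
def rayIntegral (h : ℝ × ℝ → ℂ) (φ α : ℝ) : ℂ :=
  ∫ t in Ioi (0 : ℝ), h (Phi φ + t • Phi α)

theorem ray_normSq (φ α t : ℝ) :
    (Phi φ + t • Phi α).1 ^ 2 + (Phi φ + t • Phi α).2 ^ 2 =
      1 + 2 * t * Real.cos (α - φ) + t ^ 2 := by
  simp only [Phi, Real.cos_sub, Prod.fst_add, Prod.snd_add, Prod.smul_fst, Prod.smul_snd,
    smul_eq_mul]
  linear_combination Real.sin_sq_add_cos_sq φ + t ^ 2 * Real.sin_sq_add_cos_sq α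

theorem integrable_ray {h : ℝ × ℝ → ℂ} (hc : Continuous h) (hs : Function.support h ⊆ unitDisk)
    (φ α : ℝ) : Integrable (fun t : ℝ => h (Phi φ + t • Phi α)) := by
  apply Continuous.integrable_of_hasCompactSupport (by fun_prop)
  apply HasCompactSupport.of_support_subset_isCompact (isCompact_Icc (a := (-2 : ℝ)) (b := 2))
  intro t ht
  by_contra hlt
  apply ht
  apply eq_zero_of_one_le hs
  rw [ray_normSq]
  have h1 := Real.neg_one_le_cos (α - φ)
  have h2 := Real.cos_le_one (α - φ)
  rcases le_total t 0 with h0 | h0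
  · have : t < -2 := by
      by_contra hh
      exact hlt ⟨not_lt.mp hh, by linarith⟩
    nlinarith
  · have : 2 < t := by
      by_contra hh
      exact hlt ⟨by linarith, not_lt.mp hh⟩
    nlinarith

theorem rayIntegral_eq_integral {h : ℝ × ℝ → ℂ} (hs : Function.support h ⊆ unitDisk) {φ α : ℝ}
    (hα : Real.cos (α - φ) ≤ 0) : rayIntegral h φ α = ∫ t : ℝ, h (Phi φ + t • Phi α) := by
  apply setIntegral_eq_integral_of_forall_compl_eq_zero
  intro t ht
  rw [mem_Ioi, not_lt] at ht
  apply eq_zero_of_one_le hs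
  rw [ray_normSq]
  nlinarith [mul_nonneg_of_nonpos_of_nonpos ht hα]

theorem rayIntegral_sub {h : ℝ × ℝ → ℂ} (hs : Function.support h ⊆ unitDisk) (φ : ℝ) {ψ : ℝ}
    (hψ : ψ ∈ Ioo 0 (π / 2)) :
    rayIntegral h φ (π + φ - ψ) = complexRadon h (Real.sin ψ) (φ + (π / 2 - ψ)) := by
  have hcos := Real.cos_pos_of_mem_Ioo ⟨by linarith [hψ.1, Real.pi_pos], hψ.2⟩
  rw [rayIntegral_eq_integral hs, complexRadon, ← integral_add_right_eq_self _ (Real.cos ψ)]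
  · congr 1
    ext t
    congr 1
    have h1 : φ + (π / 2 - ψ) = (φ - ψ) + π / 2 := by ring
    have h2 : φ + (π / 2 - ψ) + π / 2 = (φ - ψ) + π := by ring
    have h3 : π + φ - ψ = (φ - ψ) + π := by ring
    have h4 := Real.cos_add (φ - ψ) ψ
    have h5 := Real.sin_add (φ - ψ) ψ
    rw [sub_add_cancel] at h4 h5
    rw [h2, h1, h3]
    ext
    · simp [Phi, Real.cos_add_pi_div_two, h4]; ring
    · simp [Phi, Real.sin_add_pi_div_two, h5]; ring
  · rw [show π + φ - ψ - φ = π - ψ by ring, Real.cos_pi_sub]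
    linarith

theorem rayIntegral_add {h : ℝ × ℝ → ℂ} (hs : Function.support h ⊆ unitDisk) (φ : ℝ) {ψ : ℝ}
    (hψ : ψ ∈ Ioo 0 (π / 2)) :
    rayIntegral h φ (π + φ + ψ) = complexRadon h (Real.sin ψ) (φ - (π / 2 - ψ)) := by
  have hcos := Real.cos_pos_of_mem_Ioo ⟨by linarith [hψ.1, Real.pi_pos], hψ.2⟩
  rw [rayIntegral_eq_integral hs, complexRadon, ← integral_sub_left_eq_self _ _ (Real.cos ψ)]
  · congr 1
    ext t
    congr 1
    have h1 : φ - (π / 2 - ψ) = (φ + ψ) - π / 2 := by ring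
    have h2 : φ - (π / 2 - ψ) + π / 2 = φ + ψ := by ring
    have h3 : π + φ + ψ = (φ + ψ) + π := by ring
    have h4 := Real.cos_sub (φ + ψ) ψ
    have h5 := Real.sin_sub (φ + ψ) ψ
    rw [add_sub_cancel_right] at h4 h5
    rw [h2, h1, h3]
    ext
    · simp [Phi, Real.cos_sub_pi_div_two, h4]; ring
    · simp [Phi, Real.sin_sub_pi_div_two, h5]; ring
  · rw [show π + φ + ψ - φ = π + ψ by ring, add_comm, Real.cos_add_pi]
    linarith

theorem countable_resonant_angles {k : ℤ} (hk : Real.cos (k * (π / 2)) ≠ 0) :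
    {ψ : ℝ | ∃ n : ℤ, Real.cos (k * ψ + n * (π / 2 - ψ)) = 0}.Countable := by
  rw [ofPred_exists]
  refine countable_iUnion fun n => ?_
  by_cases hn : n = k
  · subst hn
    convert countable_empty
    ext ψ
    simp only [mem_ofPred_eq, mem_empty_iff_false, iff_false]
    rwa [show n * ψ + n * (π / 2 - ψ) = n * (π / 2) by ring]
  · refine (countable_range fun m : ℤ =>
      ((2 * m + 1) * π / 2 - n * (π / 2)) / ((k : ℝ) - n)).mono ?_
    intro ψ hψ
    obtain ⟨m, hm⟩ := Real.cos_eq_zero_iff.mp hψ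
    have hkn : (k : ℝ) - n ≠ 0 := by
      rw [sub_ne_zero]
      exact_mod_cast Ne.symm hn
    refine ⟨m, ?_⟩
    simp only
    rw [← hm, div_eq_iff hkn]
    ring

/-- Injectivity of the phased V-line transform with vertices on the unit circle. -/
theorem eq_zero_of_phased_rayIntegral_eq_zero {h : ℝ × ℝ → ℂ} (hc : Continuous h)
    (hs : Function.support h ⊆ unitDisk) {k : ℤ} (hk : Real.cos (k * (π / 2)) ≠ 0)
    (hV : ∀ φ ∈ Ico 0 (2 * π), ∀ ψ ∈ Ioo 0 (π / 2),
      Complex.exp ((k * ψ : ℝ) * Complex.I) * rayIntegral h φ (π + φ - ψ) +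
        Complex.exp (-((k * ψ : ℝ) * Complex.I)) * rayIntegral h φ (π + φ + ψ) = 0) : h = 0 := by
  set B := {ψ : ℝ | ∃ n : ℤ, Real.cos (k * ψ + n * (π / 2 - ψ)) = 0} with hB
  have hgood : ∀ ψ ∈ Ioo 0 (π / 2), ψ ∉ B → ∀ θ, complexRadon h (Real.sin ψ) θ = 0 := by
    intro ψ hψ hψB θ
    refine congrFun (periodic_eq_zero_of_phased_translates (continuous_complexRadon hc hs _)
      (complexRadon_periodic h _) (k * ψ) (π / 2 - ψ) ?_ ?_) θ
    · intro φ hφ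
      rw [← rayIntegral_sub hs φ hψ, ← rayIntegral_add hs φ hψ]
      exact hV φ hφ ψ hψ
    · intro n hn
      exact hψB ⟨n, hn⟩
  have hpos : ∀ s : ℝ, 0 < s → s ∉ Real.sin '' B → ∀ θ, complexRadon h s θ = 0 := by
    intro s hs0 hsB θ
    rcases le_or_gt 1 s with h1 | h1
    · exact complexRadon_eq_zero_of_one_le_abs hs (h1.trans (le_abs_self s)) θ
    · have hsin : Real.sin (Real.arcsin s) = s := Real.sin_arcsin (by linarith) h1.le
      rw [← hsin]
      refine hgood _ ⟨Real.arcsin_pos.mpr hs0, Real.arcsin_lt_pi_div_two.mpr h1⟩ ?_ θ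
      exact fun hmem => hsB ⟨_, hmem, hsin⟩
  have hbad : (insert 0 (Real.sin '' B ∪ Neg.neg '' (Real.sin '' B))).Countable := by
    have := (countable_resonant_angles hk).image Real.sin
    exact (this.union (this.image _)).insert 0
  refine eq_zero_of_complexRadon_ae_eq_zero hc hs fun θ => ?_
  filter_upwards [hbad.ae_notMem volume] with s hsB
  rcases lt_trichotomy s 0 with h0 | h0 | h0
  · rw [← neg_neg s, complexRadon_neg]
    refine hpos _ (by linarith) (fun hmem => hsB ?_) _
    exact Or.inr (Or.inr ⟨-s, hmem, neg_neg s⟩)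
  · exact absurd (Or.inl h0) hsB
  · exact hpos s h0 (fun hmem => hsB (Or.inr (Or.inl hmem))) θ

/-- The integral of a real-valued function over the ray from `Phi φ` in direction `Phi α`. -/
def realRayIntegral (f : ℝ × ℝ → ℝ) (φ α : ℝ) : ℝ :=
  ∫ t in Ioi (0 : ℝ), f (Phi φ + t • Phi α)

theorem integrableOn_ray_real {f : ℝ × ℝ → ℝ} (hc : Continuous f)
    (hs : Function.support f ⊆ unitDisk) (φ α : ℝ) :
    IntegrableOn (fun t : ℝ => f (Phi φ + t • Phi α)) (Ioi 0) := by
  have hs' : Function.support (fun x => (f x : ℂ)) ⊆ unitDisk := fun x hx =>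
    hs fun h0 => hx (by simp [h0])
  exact (integrable_ray (Complex.continuous_ofReal.comp hc) hs' φ α).re.integrableOn

theorem integral_pair2_ray {f11 f12 f22 : ℝ × ℝ → ℝ} {φ α : ℝ}
    (h11 : IntegrableOn (fun t : ℝ => f11 (Phi φ + t • Phi α)) (Ioi 0))
    (h12 : IntegrableOn (fun t : ℝ => f12 (Phi φ + t • Phi α)) (Ioi 0))
    (h22 : IntegrableOn (fun t : ℝ => f22 (Phi φ + t • Phi α)) (Ioi 0)) (a b : ℝ × ℝ) :
    ∫ t in Ioi (0 : ℝ), pair2 a b f11 f12 f22 (Phi φ + t • Phi α) =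
      a.1 * b.1 * realRayIntegral f11 φ α +
      (a.1 * b.2 + a.2 * b.1) * realRayIntegral f12 φ α +
      a.2 * b.2 * realRayIntegral f22 φ α := by
  simp only [pair2, realRayIntegral]
  rw [← integral_const_mul, ← integral_const_mul, ← integral_const_mul,
    ← integral_add (h11.const_mul _) (h12.const_mul _)]
  exact integral_add ((h11.const_mul _).add (h12.const_mul _)) (h22.const_mul _)

theorem rayIntegral_linear_combination {f g : ℝ × ℝ → ℝ} {φ α : ℝ}
    (hf : IntegrableOn (fun t : ℝ => f (Phi φ + t • Phi α)) (Ioi 0))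
    (hg : IntegrableOn (fun t : ℝ => g (Phi φ + t • Phi α)) (Ioi 0)) (a b : ℂ) :
    rayIntegral (fun x => a * f x + b * g x) φ α =
      a * realRayIntegral f φ α + b * realRayIntegral g φ α := by
  have hf' : IntegrableOn (fun t : ℝ => (f (Phi φ + t • Phi α) : ℂ)) (Ioi 0) := hf.ofReal
  have hg' : IntegrableOn (fun t : ℝ => (g (Phi φ + t • Phi α) : ℂ)) (Ioi 0) := hg.ofReal
  rw [rayIntegral, integral_add (hf'.const_mul a) (hg'.const_mul b),
    integral_const_mul, integral_const_mul, integral_complex_ofReal, integral_complex_ofReal]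
  rfl

theorem support_linear_combination_subset {f g : ℝ × ℝ → ℝ}
    (hf : Function.support f ⊆ unitDisk) (hg : Function.support g ⊆ unitDisk) (a b : ℂ) :
    Function.support (fun x => a * f x + b * g x) ⊆ unitDisk := by
  intro x hx
  by_contra hlt
  apply hx
  have hfx : f x = 0 := Function.notMem_support.mp fun h => hlt (hf h)
  have hgx : g x = 0 := Function.notMem_support.mp fun h => hlt (hg h)
  simp [hfx, hgx]

theorem exp_two_mul_I_eq (φ α : ℝ) :
    Complex.exp (2 * (φ - α) * Complex.I) =
      Complex.exp (2 * φ * Complex.I) * (Real.cos α - Real.sin α * Complex.I) ^ 2 := by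
  rw [Complex.ofReal_cos, Complex.ofReal_sin, ← Complex.cos_neg, ← neg_neg (Complex.sin α),
    ← Complex.sin_neg, neg_mul, sub_neg_eq_add, Complex.cos_add_sin_I, ← Complex.exp_nat_mul,
    ← Complex.exp_add]
  congr 1
  push_cast
  ring

/-- the triple of longitudinal, transverse and mixed V-line transforms is
injective on smooth symmetric 2-tensor fields supported in the open unit disk. -/
theorem L2_T2_M2_injective (f11 f12 f22 : ℝ × ℝ → ℝ)
    (hsm11 : ContDiff ℝ (⊤ : ℕ∞) f11) (hsm12 : ContDiff ℝ (⊤ : ℕ∞) f12) (hsm22 : ContDiff ℝ (⊤ : ℕ∞) f22)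
    (hsupp11 : Function.support f11 ⊆ unitDisk)
    (hsupp12 : Function.support f12 ⊆ unitDisk)
    (hsupp22 : Function.support f22 ⊆ unitDisk)
    (hL : ∀ φ ∈ Ico 0 (2 * π), ∀ ψ ∈ Ioo 0 (π / 2), L2 f11 f12 f22 φ ψ = 0)
    (hT : ∀ φ ∈ Ico 0 (2 * π), ∀ ψ ∈ Ioo 0 (π / 2), T2 f11 f12 f22 φ ψ = 0)
    (hM : ∀ φ ∈ Ico 0 (2 * π), ∀ ψ ∈ Ioo 0 (π / 2), M2 f11 f12 f22 φ ψ = 0) :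
    f11 = 0 ∧ f12 = 0 ∧ f22 = 0 := by
  have c11 := hsm11.continuous
  have c12 := hsm12.continuous
  have c22 := hsm22.continuous
  have i11 := integrableOn_ray_real c11 hsupp11
  have i12 := integrableOn_ray_real c12 hsupp12
  have i22 := integrableOn_ray_real c22 hsupp22
  have hpair := fun φ α => integral_pair2_ray (i11 φ α) (i12 φ α) (i22 φ α)
  have htrace : (fun x => (1 : ℂ) * f11 x + 1 * f22 x) = 0 := by
    refine eq_zero_of_phased_rayIntegral_eq_zero (k := 0) (by fun_prop)
      (support_linear_combination_subset hsupp11 hsupp22 _ _) (by simp) ?_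
    intro φ hφ ψ hψ
    have hl := hL φ hφ ψ hψ
    have ht := hT φ hφ ψ hψ
    simp only [L2, T2, hpair] at hl ht
    rw [rayIntegral_linear_combination (i11 _ _) (i22 _ _),
      rayIntegral_linear_combination (i11 _ _) (i22 _ _)]
    have hsum : realRayIntegral f11 φ (π + φ - ψ) + realRayIntegral f22 φ (π + φ - ψ) +
        (realRayIntegral f11 φ (π + φ + ψ) + realRayIntegral f22 φ (π + φ + ψ)) = 0 := by
      generalize π + φ - ψ = α at *
      generalize π + φ + ψ = β at *
      simp only [perp, Phi] at hl ht
      linear_combination hl + ht -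
        (realRayIntegral f11 φ α + realRayIntegral f22 φ α) * Real.sin_sq_add_cos_sq α -
        (realRayIntegral f11 φ β + realRayIntegral f22 φ β) * Real.sin_sq_add_cos_sq β
    simp only [Int.cast_zero, zero_mul, Complex.ofReal_zero, neg_zero, Complex.exp_zero, one_mul]
    exact_mod_cast hsum
  have cdiff : Continuous (fun x => f11 x - f22 x) := c11.sub c22
  have hsuppdiff : Function.support (fun x => f11 x - f22 x) ⊆ unitDisk :=
    (Function.support_sub f11 f22).trans (union_subset hsupp11 hsupp22)
  have hdev : (fun x => (1 : ℂ) * (f11 x - f22 x : ℝ) + 2 * Complex.I * f12 x) = 0 := by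
    refine eq_zero_of_phased_rayIntegral_eq_zero (k := 2) (by fun_prop)
      (support_linear_combination_subset hsuppdiff hsupp12 _ _) ?_ ?_
    · rw [show ((2 : ℤ) : ℝ) * (π / 2) = π by push_cast; ring, Real.cos_pi]
      norm_num
    intro φ hφ ψ hψ
    have hl := hL φ hφ ψ hψ
    have ht := hT φ hφ ψ hψ
    have hm := hM φ hφ ψ hψ
    simp only [L2, T2, M2, hpair] at hl ht hm
    have idiff := integrableOn_ray_real cdiff hsuppdiff
    have hsub : ∀ α, realRayIntegral (fun x => f11 x - f22 x) φ α =
        realRayIntegral f11 φ α - realRayIntegral f22 φ α := fun α =>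
      integral_sub (i11 φ α) (i22 φ α)
    rw [rayIntegral_linear_combination (idiff _ _) (i12 _ _),
      rayIntegral_linear_combination (idiff _ _) (i12 _ _), hsub, hsub]
    have e1 : Complex.exp (((2 : ℤ) * ψ : ℝ) * Complex.I) =
        Complex.exp (2 * φ * Complex.I) * (Real.cos (π + φ - ψ) -
          Real.sin (π + φ - ψ) * Complex.I) ^ 2 := by
      rw [← exp_two_mul_I_eq, ← Complex.exp_periodic (2 * (_ - _) * _)]
      congr 1
      push_cast
      ring
    have e2 : Complex.exp (-(((2 : ℤ) * ψ : ℝ) * Complex.I)) =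
        Complex.exp (2 * φ * Complex.I) * (Real.cos (π + φ + ψ) -
          Real.sin (π + φ + ψ) * Complex.I) ^ 2 := by
      rw [← exp_two_mul_I_eq, ← Complex.exp_periodic (2 * (_ - _) * _)]
      congr 1
      push_cast
      ring
    rw [e1, e2]
    generalize π + φ - ψ = α at *
    generalize π + φ + ψ = β at *
    simp only [perp, Phi] at hl ht hm
    have hl' := congrArg ((↑) : ℝ → ℂ) hl
    have ht' := congrArg ((↑) : ℝ → ℂ) ht
    have hm' := congrArg ((↑) : ℝ → ℂ) hm
    push_cast at hl' ht' hm' ⊢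
    generalize Complex.cos α = ca at *
    generalize Complex.sin α = sa at *
    generalize Complex.cos β = cb at *
    generalize Complex.sin β = sb at *
    generalize (realRayIntegral f12 φ α : ℂ) = p at *
    generalize (realRayIntegral f12 φ β : ℂ) = q at *
    linear_combination Complex.exp (2 * φ * Complex.I) * (hl' - ht' + 2 * Complex.I * hm') +
      Complex.exp (2 * φ * Complex.I) *
       (sa ^ 2 * (realRayIntegral f11 φ α - realRayIntegral f22 φ α + 2 * Complex.I * p)
       - 4 * sa * ca * p + sb ^ 2 * (realRayIntegral f11 φ β - realRayIntegral f22 φ β +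
        2 * Complex.I * q) - 4 * sb * cb * q) * Complex.I_sq
  have hpoint : ∀ x, f11 x = 0 ∧ f12 x = 0 ∧ f22 x = 0 := by
    intro x
    have h1 := congrArg Complex.re (congrFun htrace x)
    have h2 := congrArg Complex.re (congrFun hdev x)
    have h3 := congrArg Complex.im (congrFun hdev x)
    simp at h1 h2 h3
    exact ⟨by linarith, h3, by linarith⟩
  exact ⟨funext fun x => (hpoint x).1, funext fun x => (hpoint x).2.1,
    funext fun x => (hpoint x).2.2⟩
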